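/- Let A, D be real N×N matrices, P a diagonal N×N matrix with 0/1 diagonal entries, R : ℝ → ℝ^N twice continuously differentiable, and let z : ℝ → ℝ^N satisfy z''(s) + D z'(s) + A z(s) = R(s) for all s. Fix t ∈ ℝ and let z̃ : ℝ → ℝ^N be the solution of z̃''(τ) + D z̃'(τ) = (I − P) R(t) − A (I − P) z(t) + P R(t + τ) − A P z̃(τ), with initial data z̃(0) = z(t) and z̃'(0) = z'(t). Then, as Δt → 0, [ z̃(Δt) + z̃(−Δt) + (Δt/2) D ( z̃(Δt) − z̃(−Δt) ) ] − [ z(t + Δt) + z(t − Δt) + (Δt/2) D ( z(t + Δt) − z(t − Δt) ) ] = O(Δt⁴). -/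

import Mathlib

open Matrix Topology Asymptotics

lemma bigO_integrate {E : Type*} [NormedAddCommGroup E] [NormedSpace ℝ E] (f f' : ℝ → E) (n : ℕ)
    (hf : ∀ x, HasDerivAt f (f' x) x) (h0 : f 0 = 0)
    (h : f' =O[𝓝 (0 : ℝ)] fun x => x ^ n) : f =O[𝓝 (0 : ℝ)] fun x => x ^ (n + 1) := by
  obtain ⟨C, hC⟩ := h.bound
  obtain ⟨ε, hε, hb⟩ := Metric.eventually_nhds_iff_ball.1 hC
  refine IsBigO.of_bound C ?_
  filter_upwards [Metric.ball_mem_nhds (0 : ℝ) hε] with x hx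
  have hx' : |x| < ε := by simpa using hx
  have key := (convex_closedBall (0 : ℝ) |x|).norm_image_sub_le_of_norm_hasDerivWithin_le
    (f := f) (f' := f') (C := C * |x| ^ n) (x := 0) (y := x)
    (fun y _ => (hf y).hasDerivWithinAt) (fun y hy => by
      have hy' : |y| ≤ |x| := by simpa using hy
      have h1 := hb y (by simpa using lt_of_le_of_lt hy' hx')
      rw [norm_pow, Real.norm_eq_abs] at h1
      rcases le_or_gt 0 C with hC0 | hC0
      · exact h1.trans (by gcongr)
      · have h2 := hb x hx
        rw [norm_pow, Real.norm_eq_abs] at h2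
        have h3 : |x| ^ n ≤ 0 := by
          have := norm_nonneg (f' x)
          by_contra hcon
          push Not at hcon
          nlinarith
        have h4 : |x| ^ n = 0 := le_antisymm h3 (by positivity)
        have h5 : |y| ^ n = 0 := le_antisymm (h4 ▸ (by gcongr)) (by positivity)
        rw [h4, ← h5]; exact h1)
    (by simp) (by simp)
  rw [h0, sub_zero, sub_zero] at key
  rw [norm_pow, Real.norm_eq_abs, pow_succ, ← mul_assoc]
  exact key

lemma bigO_neg {E : Type*} [NormedAddCommGroup E] (f : ℝ → E) (n : ℕ)
    (h : f =O[𝓝 (0 : ℝ)] fun x => x ^ n) : (fun x => f (-x)) =O[𝓝 (0 : ℝ)] fun x => x ^ n := by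
  have ht : Filter.Tendsto (fun x : ℝ => -x) (𝓝 0) (𝓝 0) := by
    simpa using (continuous_neg (G := ℝ)).tendsto 0
  refine (h.comp_tendsto ht).trans (IsBigO.of_bound 1 (Filter.Eventually.of_forall fun x => ?_))
  simp

lemma bigO_base {E : Type*} [NormedAddCommGroup E] [NormedSpace ℝ E] (f : ℝ → E)
    (hf : Differentiable ℝ f) (h0 : f 0 = 0) : f =O[𝓝 (0 : ℝ)] fun x => x ^ 1 := by
  simpa [h0] using (hf 0).isBigO_sub

lemma hasDerivAt_neg_arg {E : Type*} [NormedAddCommGroup E] [NormedSpace ℝ E] (f : ℝ → E)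
    (hf : Differentiable ℝ f) (x : ℝ) :
    HasDerivAt (fun y => f (-y)) (-deriv f (-x)) x := by
  have h := (hf (-x)).hasDerivAt.scomp x (hasDerivAt_neg x)
  simpa [Function.comp_def] using h

lemma core {E : Type*} [NormedAddCommGroup E] [NormedSpace ℝ E] (D : E →L[ℝ] E) (w g : ℝ → E)
    (hw : ContDiff ℝ 2 w) (hg : ContDiff ℝ 2 g)
    (hode : ∀ x, deriv (deriv w) x + D (deriv w x) = g x)
    (hg0 : g 0 = 0) (hw0 : w 0 = 0) (hw1 : deriv w 0 = 0) :
    (fun x : ℝ => w x + w (-x) + (x / 2) • D (w x - w (-x))) =O[𝓝 (0 : ℝ)] fun x => x ^ 4 := by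
  have dw : Differentiable ℝ w := hw.differentiable (by norm_num)
  have dg : Differentiable ℝ g := hg.differentiable (by norm_num)
  have dw' : Differentiable ℝ (deriv w) :=
    ((contDiff_succ_iff_deriv (n := 1)).1 hw).2.2.differentiable (by norm_num)
  have dg' : Differentiable ℝ (deriv g) :=
    ((contDiff_succ_iff_deriv (n := 1)).1 hg).2.2.differentiable (by norm_num)
  have hode' : ∀ x, deriv (deriv w) x = g x - D (deriv w x) := fun x => eq_sub_of_add_eq (hode x)
  have bg := bigO_base g dg hg0
  have bw' := bigO_base _ dw' hw1
  have bw'' : deriv (deriv w) =O[𝓝 (0 : ℝ)] fun x => x ^ 1 := by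
    rw [funext hode']
    exact bg.sub ((D.isBigO_comp _ _).trans bw')
  have bw'2 := bigO_integrate _ _ 1 (fun x => (dw' x).hasDerivAt) hw1 bw''
  have bw3 := bigO_integrate _ _ 2 (fun x => (dw x).hasDerivAt) hw0 bw'2
  have bge : (fun x => g x + g (-x)) =O[𝓝 (0 : ℝ)] fun x => x ^ 2 := by
    refine bigO_integrate _ (fun x => deriv g x + -deriv g (-x)) 1
      (fun x => (dg x).hasDerivAt.add (hasDerivAt_neg_arg g dg x)) (by simp [hg0]) ?_
    refine bigO_base _ (dg'.add (dg'.comp differentiable_neg).neg) (by simp)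
  have be2 : (fun x => deriv (deriv w) x + deriv (deriv w) (-x)) =O[𝓝 (0 : ℝ)] fun x => x ^ 2 := by
    have h1 := bge.sub ((D.isBigO_comp _ _).trans (bw'2.add (bigO_neg _ _ bw'2)))
    refine h1.congr_left fun x => ?_
    rw [hode', hode', map_add]; abel
  have be1 : (fun x => deriv w x + -deriv w (-x)) =O[𝓝 (0 : ℝ)] fun x => x ^ 3 := by
    refine bigO_integrate _ (fun x => deriv (deriv w) x + deriv (deriv w) (-x)) 2
      (fun x => ?_) (by simp) be2
    have h := (dw' x).hasDerivAt.add (hasDerivAt_neg_arg _ dw' x).neg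
    rw [neg_neg] at h
    exact h
  have be0 : (fun x => w x + w (-x)) =O[𝓝 (0 : ℝ)] fun x => x ^ 4 :=
    bigO_integrate _ _ 3 (fun x => (dw x).hasDerivAt.add (hasDerivAt_neg_arg w dw x))
      (by simp [hw0]) be1
  refine be0.add ?_
  have hx : (fun x : ℝ => x / 2) =O[𝓝 (0 : ℝ)] fun x => x := by
    simpa [div_eq_inv_mul] using (isBigO_refl (fun x : ℝ => x) (𝓝 0)).const_mul_left (2⁻¹ : ℝ)
  have := hx.smul ((D.isBigO_comp _ _).trans (bw3.sub (bigO_neg _ _ bw3)))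
  refine this.congr_right fun x => ?_
  simp only [smul_eq_mul]; ring

/-- for the damped equation `z'' + D z' + A z = R`, if `z̃` solves
`z̃'' + D z̃' = (I−P)R(t) − A(I−P)z(t) + P R(t+τ) − A P z̃(τ)` with `z̃(0) = z(t)` and
`z̃'(0) = z'(t)`, then
`[z̃(Δt) + z̃(−Δt) + (Δt/2)D(z̃(Δt) − z̃(−Δt))] − [z(t+Δt) + z(t−Δt) + (Δt/2)D(z(t+Δt) − z(t−Δt))]
 = O(Δt⁴)` as `Δt → 0`. -/
theorem stmt_11 (N : ℕ) (A D P : Matrix (Fin N) (Fin N) ℝ)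
    (hPdiag : ∀ i j : Fin N, i ≠ j → P i j = 0)
    (hP01 : ∀ i : Fin N, P i i = 0 ∨ P i i = 1)
    (R z : ℝ → (Fin N → ℝ)) (hR : ContDiff ℝ 2 R) (hz : ContDiff ℝ 2 z)
    (hode : ∀ s : ℝ, deriv (deriv z) s + D.mulVec (deriv z s) + A.mulVec (z s) = R s)
    (t : ℝ) (zt : ℝ → (Fin N → ℝ)) (hzt : ContDiff ℝ 2 zt)
    (hztode : ∀ τ : ℝ, deriv (deriv zt) τ + D.mulVec (deriv zt τ)
        = ((1 : Matrix (Fin N) (Fin N) ℝ) - P).mulVec (R t)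
          - (A * ((1 : Matrix (Fin N) (Fin N) ℝ) - P)).mulVec (z t)
          + P.mulVec (R (t + τ)) - (A * P).mulVec (zt τ))
    (hzt0 : zt 0 = z t) (hzt0' : deriv zt 0 = deriv z t) :
    (fun Δt : ℝ =>
        (zt Δt + zt (-Δt) + (Δt / 2) • D.mulVec (zt Δt - zt (-Δt)))
          - (z (t + Δt) + z (t - Δt) + (Δt / 2) • D.mulVec (z (t + Δt) - z (t - Δt))))
      =O[𝓝 (0 : ℝ)] fun Δt => Δt ^ 4 := by
  have cmv : ∀ (M : Matrix (Fin N) (Fin N) ℝ) (f : ℝ → Fin N → ℝ), ContDiff ℝ 2 f →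
      ContDiff ℝ 2 fun x => M.mulVec (f x) := fun M f hf =>
    (LinearMap.toContinuousLinearMap M.mulVecLin).contDiff.comp hf
  have csh : ∀ f : ℝ → Fin N → ℝ, ContDiff ℝ 2 f → ContDiff ℝ 2 fun x => f (t + x) :=
    fun f hf => hf.comp (contDiff_const.add contDiff_id)
  have dz : Differentiable ℝ z := hz.differentiable (by norm_num)
  have dzt : Differentiable ℝ zt := hzt.differentiable (by norm_num)
  have dz' : Differentiable ℝ (deriv z) :=
    ((contDiff_succ_iff_deriv (n := 1)).1 hz).2.2.differentiable (by norm_num)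
  have dzt' : Differentiable ℝ (deriv zt) :=
    ((contDiff_succ_iff_deriv (n := 1)).1 hzt).2.2.differentiable (by norm_num)
  have e1 : deriv (fun x => zt x - z (t + x)) = fun x => deriv zt x - deriv z (t + x) := by
    funext x
    exact ((dzt x).hasDerivAt.sub ((dz (t + x)).hasDerivAt.comp_const_add t x)).deriv
  have e2 : deriv (fun x => deriv zt x - deriv z (t + x))
      = fun x => deriv (deriv zt) x - deriv (deriv z) (t + x) := by
    funext x
    exact ((dzt' x).hasDerivAt.sub ((dz' (t + x)).hasDerivAt.comp_const_add t x)).deriv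
  have h := core (LinearMap.toContinuousLinearMap D.mulVecLin) (fun x => zt x - z (t + x))
    (fun x => ((1 : Matrix (Fin N) (Fin N) ℝ) - P).mulVec (R t)
          - (A * ((1 : Matrix (Fin N) (Fin N) ℝ) - P)).mulVec (z t)
          + P.mulVec (R (t + x)) - (A * P).mulVec (zt x) - (R (t + x) - A.mulVec (z (t + x))))
    (hzt.sub (csh z hz))
    (((contDiff_const.add (cmv P _ (csh R hR))).sub (cmv (A * P) _ hzt)).sub
      ((csh R hR).sub (cmv A _ (csh z hz))))
    (fun x => by
      rw [e1, e2]
      beta_reduce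
      rw [← hztode x, ← hode (t + x)]
      simp only [LinearMap.coe_toContinuousLinearMap',
        Matrix.mulVecLin_apply, Matrix.mulVec_sub]
      abel)
    (by
      simp only [add_zero, hzt0, Matrix.mul_sub, Matrix.sub_mulVec, Matrix.mul_one,
        Matrix.one_mulVec]
      abel)
    (by simp [hzt0]) (by rw [e1]; simp [hzt0'])
  refine h.congr_left fun x => ?_
  simp only [LinearMap.coe_toContinuousLinearMap', Matrix.mulVecLin_apply, Matrix.mulVec_sub,
    ← sub_eq_add_neg, smul_sub]
  abel
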